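/- arXiv:2212.10182 — 5 statements merged into one kernel-verified Lean document; each statement's English description precedes it below -/
import Mathlib

section
/- Let k be a field of characteristic 2. Define ψ : SL₂(k) → SL₃(k) by sending the matrix with entries (a, b; c, d) to the 3×3 matrix with rows (a, 0, b), (0, 1, 0), (c, 0, d). Then ψ is an injective group homomorphism, and its image is exactly the set of matrices M ∈ SL₃(k) satisfying J₃ · ᵗM⁻¹ · J₃ = M (equivalently, ᵗM · J₃ · M = J₃). In other words, ψ identifies SL₂(k) with the fixed-point group of the involution M ↦ J₃ ᵗM⁻¹ J₃ on SL₃(k). -/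
open Matrix

/-- The fixed points of `M ↦ J (M⁻¹)ᵀ J`, for an involutory matrix `J`, are the isometries of the
bilinear form with Gram matrix `J`. -/
theorem mul_transpose_inv_mul_eq_iff {n R : Type*} [Fintype n] [DecidableEq n] [CommRing R]
    {J M : Matrix n n R} (hJ : J * J = 1) (hM : IsUnit M.det) :
    J * (M⁻¹)ᵀ * J = M ↔ Mᵀ * J * M = J := by
  have h₁ : Mᵀ * (M⁻¹)ᵀ = 1 := by
    rw [← Matrix.transpose_mul, Matrix.nonsing_inv_mul _ hM, Matrix.transpose_one]
  have h₂ : (M⁻¹)ᵀ * Mᵀ = 1 := by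
    rw [← Matrix.transpose_mul, Matrix.mul_nonsing_inv _ hM, Matrix.transpose_one]
  constructor
  · intro h
    calc Mᵀ * J * M = Mᵀ * J * (J * (M⁻¹)ᵀ * J) := by rw [h]
      _ = Mᵀ * (J * J) * (M⁻¹)ᵀ * J := by simp only [Matrix.mul_assoc]
      _ = J := by rw [hJ, Matrix.mul_one, h₁, Matrix.one_mul]
  · intro h
    calc J * (M⁻¹)ᵀ * J = J * (M⁻¹)ᵀ * (Mᵀ * J * M) := by rw [h]
      _ = J * ((M⁻¹)ᵀ * Mᵀ) * J * M := by simp only [Matrix.mul_assoc]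
      _ = M := by rw [h₂, Matrix.mul_one, hJ, Matrix.one_mul]

/-- In characteristic two, an isometry of the form `x₀ y₂ + x₁ y₁ + x₂ y₀` fixes the middle basis
vector and preserves the plane spanned by the other two. -/
theorem eq_of_transpose_mul_antidiagonal_mul_self {k : Type*} [Field k] [CharP k 2]
    {M : Matrix (Fin 3) (Fin 3) k}
    (h : Mᵀ * !![0, 0, 1; 0, 1, 0; 1, 0, 0] * M = !![0, 0, 1; 0, 1, 0; 1, 0, 0]) :
    M = !![M 0 0, 0, M 0 2; 0, 1, 0; M 2 0, 0, M 2 2] ∧ M 0 0 * M 2 2 - M 0 2 * M 2 0 = 1 := by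
  have two : (2 : k) = 0 := CharTwo.two_eq_zero
  have e (i j : Fin 3) := congrFun (congrFun h i) j
  have e00 := e 0 0
  have e11 := e 1 1
  have e22 := e 2 2
  have e01 := e 0 1
  have e21 := e 2 1
  have e02 := e 0 2
  simp [Matrix.mul_apply, Fin.sum_univ_three] at e00 e11 e22 e01 e21 e02
  have h10 : M 1 0 = 0 := by
    refine pow_eq_zero_iff two_ne_zero |>.mp ?_
    linear_combination e00 - M 0 0 * M 2 0 * two
  have h12 : M 1 2 = 0 := by
    refine pow_eq_zero_iff two_ne_zero |>.mp ?_
    linear_combination e22 - M 0 2 * M 2 2 * two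
  have h11 : M 1 1 = 1 := by
    refine sub_eq_zero.mp (pow_eq_zero_iff two_ne_zero |>.mp ?_)
    linear_combination e11 - (M 0 1 * M 2 1 + M 1 1 - 1) * two
  rw [h10] at e01 e02
  rw [h12] at e21 e02
  have hdet : M 0 0 * M 2 2 - M 0 2 * M 2 0 = 1 := by
    linear_combination e02 - M 0 2 * M 2 0 * two
  have h01 : M 0 1 = 0 := by
    linear_combination (-M 0 1) * hdet + M 0 0 * e21 - M 0 2 * e01
  have h21 : M 2 1 = 0 := by
    linear_combination (-M 2 1) * hdet + M 2 2 * e01 - M 2 0 * e21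
  refine ⟨?_, hdet⟩
  ext i j
  fin_cases i <;> fin_cases j <;> simp [h10, h11, h12, h01, h21]

/-- Let `k` be a field of characteristic `2`, and let `ψ : SL₂(k) → M₃(k)` send
`(a b; c d)` to the matrix with rows `(a, 0, b)`, `(0, 1, 0)`, `(c, 0, d)`. Then `ψ` is an
injective multiplicative map landing in `SL₃(k)`, and for every `M ∈ SL₃(k)` the fixed-point
condition `J₃ (M⁻¹)ᵀ J₃ = M` is equivalent to `Mᵀ J₃ M = J₃` and holds exactly when `M` is in the
image of `ψ`. Thus `ψ` identifies `SL₂(k)` with the fixed points of the involution on `SL₃(k)`. -/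
theorem stmt_8 {k : Type*} [Field k] [CharP k 2]
    (J : Matrix (Fin 3) (Fin 3) k) (hJ : J = !![0, 0, -1; 0, 1, 0; -1, 0, 0])
    (ψ : Matrix.SpecialLinearGroup (Fin 2) k → Matrix (Fin 3) (Fin 3) k)
    (hψ : ∀ (g : Matrix.SpecialLinearGroup (Fin 2) k) (a b c d : k),
      (g : Matrix (Fin 2) (Fin 2) k) = !![a, b; c, d] →
      ψ g = !![a, 0, b; 0, 1, 0; c, 0, d]) :
    (∀ g, (ψ g).det = 1) ∧
    (∀ g h, ψ (g * h) = ψ g * ψ h) ∧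
    Function.Injective ψ ∧
    (∀ M : Matrix (Fin 3) (Fin 3) k, M.det = 1 →
      ((J * (M⁻¹)ᵀ * J = M ↔ Mᵀ * J * M = J) ∧
       (J * (M⁻¹)ᵀ * J = M ↔ ∃ g, ψ g = M))) := by
  have hJ' : J = !![0, 0, 1; 0, 1, 0; 1, 0, 0] := by rw [hJ, CharTwo.neg_eq]
  have hJJ : J * J = 1 := by
    rw [hJ']
    ext i j
    fin_cases i <;> fin_cases j <;> simp [Matrix.mul_apply, Fin.sum_univ_three]
  have hψ' (g : Matrix.SpecialLinearGroup (Fin 2) k) :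
      ψ g = !![g.1 0 0, 0, g.1 0 1; 0, 1, 0; g.1 1 0, 0, g.1 1 1] :=
    hψ g _ _ _ _ (Matrix.eta_fin_two _)
  have hdet (g : Matrix.SpecialLinearGroup (Fin 2) k) :
      g.1 0 0 * g.1 1 1 - g.1 0 1 * g.1 1 0 = 1 := by
    rw [← Matrix.det_fin_two, g.2]
  refine ⟨fun g => ?_, fun g h => ?_, fun g h hgh => ?_, fun M hM => ?_⟩
  · rw [hψ', Matrix.det_fin_three]
    simpa using hdet g
  · rw [hψ', hψ', hψ']
    ext i j
    fin_cases i <;> fin_cases j <;>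
      simp [Matrix.mul_apply, Fin.sum_univ_three, Fin.sum_univ_two]
  · rw [hψ', hψ'] at hgh
    have e (i j : Fin 3) := congrFun (congrFun hgh i) j
    ext i j
    fin_cases i <;> fin_cases j
    · simpa using e 0 0
    · simpa using e 0 2
    · simpa using e 2 0
    · simpa using e 2 2
  · have hiff := mul_transpose_inv_mul_eq_iff hJJ (M := M) (by simp [hM])
    refine ⟨hiff, hiff.trans ⟨fun h => ?_, ?_⟩⟩
    · rw [hJ'] at h
      obtain ⟨hM', hd⟩ := eq_of_transpose_mul_antidiagonal_mul_self h
      refine ⟨⟨!![M 0 0, M 0 2; M 2 0, M 2 2], by rw [Matrix.det_fin_two_of, hd]⟩, ?_⟩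
      exact (hψ _ _ _ _ _ rfl).trans hM'.symm
    · rintro ⟨g, rfl⟩
      have hg := hdet g
      have two : (2 : k) = 0 := CharTwo.two_eq_zero
      rw [hψ', hJ']
      ext i j
      fin_cases i <;> fin_cases j <;> simp [Matrix.mul_apply, Fin.sum_univ_three]
      · linear_combination g.1 0 0 * g.1 1 0 * two
      · linear_combination hg + g.1 0 1 * g.1 1 0 * two
      · linear_combination hg + g.1 0 1 * g.1 1 0 * two
      · linear_combination g.1 0 1 * g.1 1 1 * two
end

section
/- Let k be an algebraically closed field of characteristic different from 2, and let φ : SL₂(k) → SL₃(k) be the group homomorphism sending the matrix with entries (a, b; c, d) to the 3×3 matrix with rows (a², ab, b²/2), (2ac, ad+bc, bd), (2c², 2cd, d²). Then every M ∈ SL₃(k) satisfying J₃ · ᵗM⁻¹ · J₃ = M lies in the image of φ; together with ker φ = {I, −I}, this shows φ induces an isomorphism of PSL₂(k) = PGL₂(k) onto the fixed-point group {M ∈ SL₃(k) : J₃ ᵗM⁻¹ J₃ = M}. -/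
open Matrix

/-- Over an algebraically closed field, an isotropic vector of `y² - 2xz` is the vector of
coefficients of the square of a linear form. -/
theorem exists_sq_mul_sq_eq {k : Type*} [Field k] [IsAlgClosed k] {x y z : k}
    (h : y ^ 2 = 2 * x * z) : ∃ a b : k, a ^ 2 = x ∧ a * b = y ∧ b ^ 2 = 2 * z := by
  by_cases hx : x = 0
  · obtain ⟨b, hb⟩ := IsAlgClosed.exists_pow_nat_eq (2 * z) two_pos
    have hy : y = 0 := by simpa [hx] using h
    exact ⟨0, b, by simp [hx], by simp [hy], hb⟩
  · obtain ⟨a, ha⟩ := IsAlgClosed.exists_pow_nat_eq x two_pos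
    have ha0 : a ≠ 0 := by rintro rfl; simp at ha; exact hx ha.symm
    refine ⟨a, y / a, ha, by field_simp, ?_⟩
    field_simp
    rw [h, ha]
    ring

/-- A matrix of determinant one that is fixed by `M ↦ J (M⁻¹)ᵀ J`, for an involution `J`,
preserves the bilinear form of `J`. -/
theorem mul_mul_transpose_eq_of_fixed {n k : Type*} [Fintype n] [DecidableEq n] [CommRing k]
    {J M : Matrix n n k} (hJ : J * J = 1) (hM : M.det = 1) (h : J * (M⁻¹)ᵀ * J = M) :
    M * J * Mᵀ = J := by
  have hu : IsUnit M.det := by simp [hM]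
  calc M * J * Mᵀ = J * (M⁻¹)ᵀ * (J * J) * Mᵀ := by rw [← Matrix.mul_assoc, h]
    _ = J * ((M⁻¹)ᵀ * Mᵀ) := by rw [hJ, Matrix.mul_one, Matrix.mul_assoc]
    _ = J := by rw [← Matrix.transpose_mul, Matrix.mul_nonsing_inv _ hu]; simp

/-- Let `k` be an algebraically closed field of characteristic different from
`2`, and let `φ : SL₂(k) → M₃(k)` send `(a b; c d)` to the matrix with rows `(a², ab, b²/2)`,
`(2ac, ad + bc, bd)`, `(2c², 2cd, d²)`. Then every `M` of determinant `1` fixed by the involution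
`M ↦ J₃ (M⁻¹)ᵀ J₃` lies in the image of `φ`, and the kernel of `φ` is `{I, -I}`; so `φ` induces
an isomorphism of `PGL₂(k)` onto the fixed-point group. -/
theorem stmt_9 {k : Type*} [Field k] [IsAlgClosed k] (hchar : ringChar k ≠ 2)
    (J : Matrix (Fin 3) (Fin 3) k) (hJ : J = !![0, 0, -1; 0, 1, 0; -1, 0, 0])
    (φ : Matrix.SpecialLinearGroup (Fin 2) k → Matrix (Fin 3) (Fin 3) k)
    (hφ : ∀ (g : Matrix.SpecialLinearGroup (Fin 2) k) (a b c d : k),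
      (g : Matrix (Fin 2) (Fin 2) k) = !![a, b; c, d] →
      φ g = !![a ^ 2, a * b, b ^ 2 / 2;
               2 * (a * c), a * d + b * c, b * d;
               2 * c ^ 2, 2 * (c * d), d ^ 2]) :
    (∀ M : Matrix (Fin 3) (Fin 3) k, M.det = 1 → J * (M⁻¹)ᵀ * J = M →
      ∃ g, φ g = M) ∧
    (∀ g, φ g = (1 : Matrix (Fin 3) (Fin 3) k) ↔
      ((g : Matrix (Fin 2) (Fin 2) k) = 1 ∨
        (g : Matrix (Fin 2) (Fin 2) k) = -1)) := by
  have h2 : (2 : k) ≠ 0 := Ring.two_ne_zero hchar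
  refine ⟨fun M hdet hM => ?_, fun g => ?_⟩
  · have hJJ : J * J = 1 := by
      subst hJ
      ext i j
      fin_cases i <;> fin_cases j <;> simp [Matrix.mul_apply, Fin.sum_univ_three]
    have hform := mul_mul_transpose_eq_of_fixed hJJ hdet hM
    have entry (i j : Fin 3) :
        M i 1 * M j 1 - M i 2 * M j 0 - M i 0 * M j 2 = J i j := by
      have := congrFun (congrFun hform i) j
      rw [← this, hJ]
      simp [Matrix.mul_apply, Fin.sum_univ_three]
      ring
    have e00 := entry 0 0
    have e01 := entry 0 1
    have e02 := entry 0 2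
    have e12 := entry 1 2
    have e22 := entry 2 2
    simp [hJ] at e00 e01 e02 e12 e22
    rw [Matrix.det_fin_three] at hdet
    obtain ⟨a, b, ha, hab, hb⟩ := exists_sq_mul_sq_eq
      (show M 0 1 ^ 2 = 2 * M 0 0 * M 0 2 by linear_combination e00)
    obtain ⟨c, d, hc, hcd, hd, hΔ⟩ : ∃ c d : k, 2 * c ^ 2 = M 2 0 ∧ 2 * (c * d) = M 2 1 ∧
        d ^ 2 = M 2 2 ∧ a * d - b * c = 1 := by
      obtain ⟨d, c', hd, hcd, hc'⟩ := exists_sq_mul_sq_eq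
        (show M 2 1 ^ 2 = 2 * M 2 2 * M 2 0 by linear_combination e22)
      obtain ⟨c, rfl⟩ : ∃ c, c' = 2 * c := ⟨c' / 2, by field_simp⟩
      have hc : 2 * c ^ 2 = M 2 0 := mul_left_cancel₀ h2 (by linear_combination hc')
      have hsq : (a * d - b * c) ^ 2 = 1 := by
        rw [← ha, ← hab, ← hcd, ← hd, ← hc] at e02
        linear_combination -e02 + c ^ 2 * hb
      rcases (sq_eq_sq_iff_eq_or_eq_neg.mp (hsq.trans (one_pow 2).symm)) with h | h
      · exact ⟨c, d, hc, by linear_combination hcd, hd, h⟩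
      · exact ⟨-c, -d, by linear_combination hc, by linear_combination hcd,
          by linear_combination hd, by linear_combination -h⟩
    rw [← ha, ← hab, ← hc, ← hcd, ← hd] at hdet
    rw [← ha, ← hab] at e01
    rw [← hc, ← hcd, ← hd] at e12
    have hpair : M 1 1 * (a * d + b * c) - M 1 0 * (b * d) - M 1 2 * (2 * (a * c)) = 1 := by
      linear_combination hdet + (M 1 0 * (c * d) - M 1 1 * c ^ 2) * hb -
        (M 1 1 * (a * d + b * c) - M 1 0 * (b * d) - M 1 2 * (2 * (a * c))) * hΔ
    have h10 : 2 * (a * c) = M 1 0 := by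
      linear_combination -(2 * (a * c)) * hpair + a ^ 2 * e12 + 2 * c ^ 2 * e01 -
        c ^ 2 * M 1 0 * hb + M 1 0 * (a * d - b * c + 1) * hΔ
    have h11 : a * d + b * c = M 1 1 := by
      linear_combination -(a * d + b * c) * hpair + a * b * e12 + 2 * (c * d) * e01 -
        c * d * M 1 0 * hb + M 1 1 * (a * d - b * c + 1) * hΔ
    have h12 : b * d = M 1 2 := by
      refine mul_left_cancel₀ h2 ?_
      linear_combination -(2 * (b * d)) * hpair + b ^ 2 * e12 + 2 * d ^ 2 * e01 -
        d ^ 2 * M 1 0 * hb + 2 * M 1 2 * (a * d - b * c + 1) * hΔ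
    let g : Matrix.SpecialLinearGroup (Fin 2) k :=
      ⟨!![a, b; c, d], by rw [Matrix.det_fin_two_of, hΔ]⟩
    have hb' : b ^ 2 / 2 = M 0 2 := by rw [hb]; field_simp
    refine ⟨g, ?_⟩
    rw [hφ g a b c d rfl, ha, hab, hb', hc, hcd, hd, h10, h11, h12]
    exact (Matrix.eta_fin_three M).symm
  · obtain ⟨a, b, c, d, hg⟩ : ∃ a b c d : k,
        (g : Matrix (Fin 2) (Fin 2) k) = !![a, b; c, d] :=
      ⟨_, _, _, _, Matrix.eta_fin_two _⟩
    have hΔ : a * d - b * c = 1 := by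
      rw [← Matrix.det_fin_two_of, ← hg, g.det_coe]
    rw [hφ g a b c d hg, hg]
    constructor
    · intro h
      have h00 : a ^ 2 = 1 := by simpa using congrFun (congrFun h 0) 0
      have h01 : a * b = 0 := by simpa using congrFun (congrFun h 0) 1
      have h10 : 2 * (a * c) = 0 := by simpa using congrFun (congrFun h 1) 0
      have hb : b = 0 := by linear_combination a * h01 - b * h00
      have hc : c = 0 := mul_left_cancel₀ h2 (by linear_combination a * h10 - 2 * c * h00)
      have hd : d = a := by linear_combination a * hΔ - d * h00 + a * c * hb
      subst hb hc hd
      rcases sq_eq_sq_iff_eq_or_eq_neg.mp (h00.trans (one_pow 2).symm) with rfl | rfl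
      · left; ext i j; fin_cases i <;> fin_cases j <;> simp
      · right; ext i j; fin_cases i <;> fin_cases j <;> simp
    · have entries (ε : k) (hε : ε ^ 2 = 1) (h : !![a, b; c, d] = !![ε, 0; 0, ε]) :
          !![a ^ 2, a * b, b ^ 2 / 2; 2 * (a * c), a * d + b * c, b * d;
            2 * c ^ 2, 2 * (c * d), d ^ 2] = (1 : Matrix (Fin 3) (Fin 3) k) := by
        have ha : a = ε := by simpa using congrFun (congrFun h 0) 0
        have hb : b = 0 := by simpa using congrFun (congrFun h 0) 1
        have hc : c = 0 := by simpa using congrFun (congrFun h 1) 0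
        have hd : d = ε := by simpa using congrFun (congrFun h 1) 1
        subst ha hb hc hd
        rw [Matrix.one_fin_three]
        simp [← sq, hε]
      rintro (h | h)
      · exact entries 1 (by ring) (by rw [h, Matrix.one_fin_two])
      · exact entries (-1) (by ring) (by rw [h, Matrix.one_fin_two]; simp)
end

section
/- Let R be a commutative ring, n ≥ 1, and 1 ≤ i ≤ n. Define f_{i,n} : SL₃(R) → M_{2n+1}(R) sending M = (m_{rs})_{1≤r,s≤3} to the (2n+1)×(2n+1) matrix N with N_{i,i} = m₁₁, N_{i,n+1} = m₁₂, N_{i,2n+2−i} = (−1)^{i+n} m₁₃, N_{n+1,i} = m₂₁, N_{n+1,n+1} = m₂₂, N_{n+1,2n+2−i} = (−1)^{i+n} m₂₃, N_{2n+2−i,i} = (−1)^{i+n} m₃₁, N_{2n+2−i,n+1} = (−1)^{i+n} m₃₂, N_{2n+2−i,2n+2−i} = m₃₃, N_{j,j} = 1 for all j ∉ {i, n+1, 2n+2−i}, and all other entries 0. Then f_{i,n} is an injective group homomorphism SL₃(R) → SL_{2n+1}(R), and it is equivariant for the involutions: f_{i,n}(J₃ ᵗM⁻¹ J₃) = J_{2n+1}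 ᵗf_{i,n}(M)⁻¹ J_{2n+1} for all M ∈ SL₃(R). -/
open Matrix

section ExtendByOne

variable {R m ι : Type*}

/-- The equivalence splitting `ι` into the image of an embedding and its complement. -/
noncomputable def splitRange (p : m ↪ ι) : m ⊕ {x // x ∉ Set.range p} ≃ ι :=
  open Classical in
  ((Equiv.ofInjective p p.injective).sumCongr (Equiv.refl _)).trans
    (Equiv.Set.sumCompl (Set.range p))

theorem splitRange_inl (p : m ↪ ι) (a : m) : splitRange p (Sum.inl a) = p a := by
  simp only [splitRange, Equiv.trans_apply, Equiv.sumCongr_apply, Sum.map_inl]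
  classical exact Equiv.Set.sumCompl_apply_inl _ _

theorem splitRange_inr (p : m ↪ ι) (x : {x // x ∉ Set.range p}) :
    splitRange p (Sum.inr x) = x := by
  simp only [splitRange, Equiv.trans_apply, Equiv.sumCongr_apply, Sum.map_inr, Equiv.refl_apply]
  classical exact Equiv.Set.sumCompl_apply_inr _ _

/-- Extend a square matrix along an embedding of its index type by an identity block. -/
noncomputable def extendByOne [CommRing R] [DecidableEq ι] (p : m ↪ ι) (A : Matrix m m R) : Matrix ι ι R :=
  (fromBlocks A 0 0 1).submatrix (splitRange p).symm (splitRange p).symm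

theorem eq_extendByOne_iff [CommRing R] [DecidableEq ι] (p : m ↪ ι) (A : Matrix m m R) (B : Matrix ι ι R) :
    B = extendByOne p A ↔
      (∀ a b, B (p a) (p b) = A a b) ∧
      (∀ a k, k ∉ Set.range p → B (p a) k = 0) ∧
      (∀ j b, j ∉ Set.range p → B j (p b) = 0) ∧
      (∀ j k, j ∉ Set.range p → k ∉ Set.range p → B j k = if j = k then 1 else 0) := by
  have h : B = extendByOne p A ↔
      B.submatrix (splitRange p) (splitRange p) = fromBlocks A 0 0 1 := by
    constructor
    · rintro rfl
      simp [extendByOne]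
    · intro h
      simp [extendByOne, ← h]
  rw [h, ← Matrix.ext_iff]
  simp only [Sum.forall, submatrix_apply, splitRange_inl, splitRange_inr, fromBlocks_apply₁₁,
    fromBlocks_apply₁₂, fromBlocks_apply₂₁, fromBlocks_apply₂₂, Subtype.forall, Matrix.zero_apply,
    one_apply, Subtype.mk.injEq]
  grind

theorem extendByOne_mul [CommRing R] [Fintype m] [Fintype ι] [DecidableEq ι] (p : m ↪ ι) (A B : Matrix m m R) :
    extendByOne p (A * B) = extendByOne p A * extendByOne p B := by
  classical
  simp [extendByOne, submatrix_mul_equiv, fromBlocks_multiply]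

theorem extendByOne_one [CommRing R] [DecidableEq m] [DecidableEq ι] (p : m ↪ ι) : extendByOne p (1 : Matrix m m R) = 1 := by
  simp [extendByOne, fromBlocks_one]

theorem det_extendByOne [CommRing R] [Fintype m] [DecidableEq m] [Fintype ι] [DecidableEq ι]
    (p : m ↪ ι) (A : Matrix m m R) : (extendByOne p A).det = A.det := by
  classical
  rw [extendByOne, det_submatrix_equiv_self, det_fromBlocks_zero₂₁, det_one, mul_one]

theorem extendByOne_transpose [CommRing R] [DecidableEq ι] (p : m ↪ ι) (A : Matrix m m R) :
    extendByOne p Aᵀ = (extendByOne p A)ᵀ := by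
  simp [extendByOne, transpose_submatrix, fromBlocks_transpose]

theorem extendByOne_injective [CommRing R] [DecidableEq ι] (p : m ↪ ι) :
    Function.Injective (extendByOne p : Matrix m m R → Matrix ι ι R) := by
  intro A B h
  ext a b
  rw [← ((eq_extendByOne_iff p A _).1 rfl).1, h, ((eq_extendByOne_iff p B _).1 rfl).1]

end ExtendByOne

/-- The entries of `J X J` when `J` is a signed reversal matrix. -/
theorem signed_rev_conj_apply {R : Type*} [CommRing R] {N : ℕ} (s : Fin N → R)
    (J X : Matrix (Fin N) (Fin N) R)
    (hJ : ∀ j k, J j k = if k = j.rev then s j else 0) (hs : ∀ j, s j.rev = s j) (j k : Fin N) :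
    (J * X * J) j k = s j * s k * X j.rev k.rev := by
  have h (l : Fin N) : (k = l.rev) ↔ l = k.rev := by
    rw [eq_comm, Fin.rev_eq_iff]
  simp only [mul_apply, hJ, h, ite_mul, zero_mul, mul_ite, mul_zero, Finset.sum_ite_eq',
    Finset.mem_univ, if_true, hs]
  ring

/-- Let `R` be a commutative ring, `n ≥ 1` and `1 ≤ i ≤ n`. Let
`F = f_{i,n} : M₃(R) → M_{2n+1}(R)` be the signed block embedding described entrywise below
(using `0`-indexed positions `i - 1`, `n`, `2n + 1 - i`, corresponding to the `1`-indexed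
positions `i`, `n + 1`, `2n + 2 - i`). Then `F` restricts to an injective multiplicative map
`SL₃(R) → SL_{2n+1}(R)`, equivariant for the involutions `M ↦ J₃ (M⁻¹)ᵀ J₃` and
`N ↦ J_{2n+1} (N⁻¹)ᵀ J_{2n+1}`. -/
theorem stmt_11 {R : Type*} [CommRing R] (n i : ℕ) (hn : 1 ≤ n) (hi1 : 1 ≤ i) (hin : i ≤ n)
    (J3 : Matrix (Fin 3) (Fin 3) R) (hJ3 : J3 = !![0, 0, -1; 0, 1, 0; -1, 0, 0])
    (J : Matrix (Fin (2 * n + 1)) (Fin (2 * n + 1)) R)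
    (hJ : ∀ j k : Fin (2 * n + 1), J j k =
      if (j : ℕ) + (k : ℕ) = 2 * n then (if (j : ℕ) % 2 = 1 then 1 else -1) else 0)
    (F : Matrix (Fin 3) (Fin 3) R → Matrix (Fin (2 * n + 1)) (Fin (2 * n + 1)) R)
    (hF : ∀ (M : Matrix (Fin 3) (Fin 3) R) (j k : Fin (2 * n + 1)), F M j k =
      if (j : ℕ) = i - 1 ∧ (k : ℕ) = i - 1 then M 0 0
      else if (j : ℕ) = i - 1 ∧ (k : ℕ) = n then M 0 1
      else if (j : ℕ) = i - 1 ∧ (k : ℕ) = 2 * n + 1 - i then (-1 : R) ^ (i + n) * M 0 2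
      else if (j : ℕ) = n ∧ (k : ℕ) = i - 1 then M 1 0
      else if (j : ℕ) = n ∧ (k : ℕ) = n then M 1 1
      else if (j : ℕ) = n ∧ (k : ℕ) = 2 * n + 1 - i then (-1 : R) ^ (i + n) * M 1 2
      else if (j : ℕ) = 2 * n + 1 - i ∧ (k : ℕ) = i - 1 then (-1 : R) ^ (i + n) * M 2 0
      else if (j : ℕ) = 2 * n + 1 - i ∧ (k : ℕ) = n then (-1 : R) ^ (i + n) * M 2 1
      else if (j : ℕ) = 2 * n + 1 - i ∧ (k : ℕ) = 2 * n + 1 - i then M 2 2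
      else if j = k then 1 else 0) :
    (∀ M : Matrix (Fin 3) (Fin 3) R, M.det = 1 → (F M).det = 1) ∧
    (∀ M N : Matrix (Fin 3) (Fin 3) R, M.det = 1 → N.det = 1 →
      F (M * N) = F M * F N) ∧
    (∀ M N : Matrix (Fin 3) (Fin 3) R, M.det = 1 → N.det = 1 → F M = F N → M = N) ∧
    (∀ M : Matrix (Fin 3) (Fin 3) R, M.det = 1 →
      F (J3 * (M⁻¹)ᵀ * J3) = J * ((F M)⁻¹)ᵀ * J) := by
  obtain ⟨p, p0, p1, p2⟩ : ∃ p : Fin 3 ↪ Fin (2 * n + 1),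
      (p 0 : ℕ) = i - 1 ∧ (p 1 : ℕ) = n ∧ (p 2 : ℕ) = 2 * n + 1 - i := by
    refine ⟨⟨![⟨i - 1, by omega⟩, ⟨n, by omega⟩, ⟨2 * n + 1 - i, by omega⟩], ?_⟩, rfl, rfl, rfl⟩
    intro a b
    fin_cases a <;> fin_cases b <;> simp <;> omega
  set ε : R := (-1) ^ (i + n) with hε
  have hεε : ε * ε = 1 := by rw [hε, ← mul_pow]; simp
  let d : Fin 3 → R := ![1, 1, ε]
  let D : Matrix (Fin 3) (Fin 3) R := diagonal d
  have hDD : D * D = 1 := by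
    rw [diagonal_mul_diagonal, ← diagonal_one]
    congr 1
    ext a
    fin_cases a <;> simp [d, hεε]
  have hdetD : D.det * D.det = 1 := by rw [← det_mul, hDD, det_one]
  have hmem (j : Fin (2 * n + 1)) : j ∉ Set.range p ↔
      (j : ℕ) ≠ i - 1 ∧ (j : ℕ) ≠ n ∧ (j : ℕ) ≠ 2 * n + 1 - i := by
    simp only [Set.mem_range, not_exists, Fin.ext_iff]
    rw [← p0, ← p2]
    simp [Fin.forall_fin_succ, p1, eq_comm (b := (j : ℕ))]
  have hFe (M) : F M = extendByOne p (D * M * D) := by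
    rw [eq_extendByOne_iff]
    refine ⟨fun a b ↦ ?_, fun a k hk ↦ ?_, fun j b hj ↦ ?_, fun j k hj hk ↦ ?_⟩
    · rw [hF, mul_diagonal, diagonal_mul]
      have h1 : i - 1 ≠ n := by omega
      have h2 : i - 1 ≠ 2 * n + 1 - i := by omega
      have h3 : n ≠ 2 * n + 1 - i := by omega
      fin_cases a <;> fin_cases b <;>
        simp [p0, p1, p2, d, h1, h2, h3, h1.symm, h2.symm, h3.symm, mul_comm _ ε]
      rw [← mul_assoc, hεε, one_mul]
    · rw [hF]
      have hne : p a ≠ k := fun h ↦ hk ⟨a, h⟩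
      obtain ⟨h1, h2, h3⟩ := (hmem k).1 hk
      simp [h1, h2, h3, hne]
    · rw [hF]
      have hne : j ≠ p b := fun h ↦ hj ⟨b, h.symm⟩
      obtain ⟨h1, h2, h3⟩ := (hmem j).1 hj
      simp [h1, h2, h3, hne]
    · rw [hF]
      obtain ⟨h1, h2, h3⟩ := (hmem j).1 hj
      simp [h1, h2, h3]
  have hFmul (M N) : F (M * N) = F M * F N := by
    rw [hFe, hFe, hFe, ← extendByOne_mul]
    congr 1
    calc D * (M * N) * D = D * M * 1 * N * D := by simp only [mul_assoc, one_mul]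
      _ = D * M * D * (D * N * D) := by rw [← hDD]; simp only [mul_assoc]
  have hFone : F 1 = 1 := by rw [hFe, mul_one, hDD, extendByOne_one]
  refine ⟨fun M hM ↦ ?_, fun M N _ _ ↦ hFmul M N, fun M N _ _ h ↦ ?_, fun M hM ↦ ?_⟩
  · rw [hFe, det_extendByOne, det_mul, det_mul, hM, mul_one, hdetD]
  · rw [hFe, hFe] at h
    have h := extendByOne_injective p h
    have key (X : Matrix (Fin 3) (Fin 3) R) : D * (D * X * D) * D = X := by
      rw [← mul_assoc, ← mul_assoc, hDD, one_mul, mul_assoc, hDD, mul_one]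
    rw [← key M, h, key]
  · have hinv : (F M)⁻¹ = F M⁻¹ := by
      refine inv_eq_right_inv ?_
      rw [← hFmul, mul_nonsing_inv _ (by simp [hM]), hFone]
    have htr : (F M⁻¹)ᵀ = F (M⁻¹)ᵀ := by
      rw [hFe, hFe, ← extendByOne_transpose]
      simp [D, transpose_mul, mul_assoc]
    rw [hinv, htr]
    generalize (M⁻¹)ᵀ = B
    let t : Fin 3 → R := ![-1, 1, -1]
    have hJ3' (a b : Fin 3) : J3 a b = if b = a.rev then t a else 0 := by
      rw [hJ3]
      fin_cases a <;> fin_cases b <;> simp [t, Fin.ext_iff]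
    have htrev (a : Fin 3) : t a.rev = t a := by fin_cases a <;> rfl
    let s : Fin (2 * n + 1) → R := fun j ↦ (-1) ^ ((j : ℕ) + 1)
    have hJ' (j k : Fin (2 * n + 1)) : J j k = if k = j.rev then s j else 0 := by
      rw [hJ]
      have : (j : ℕ) + k = 2 * n ↔ k = j.rev := by
        rw [Fin.ext_iff, Fin.val_rev]
        omega
      simp only [this, s]
      split_ifs with h1 h2
      · rw [Even.neg_one_pow (by rw [Nat.even_iff]; omega)]
      · rw [Odd.neg_one_pow (by rw [Nat.odd_iff]; omega)]
      · rfl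
    have hss (j : Fin (2 * n + 1)) : s j * s j = 1 := by
      simp [s, ← mul_pow]
    have hsrev (j : Fin (2 * n + 1)) : s j.rev = s j := by
      simp only [s, Fin.val_rev]
      refine neg_one_pow_congr ?_
      simp only [Nat.even_iff]
      omega
    have hrev (a : Fin 3) : (p a).rev = p a.rev := by
      fin_cases a <;> simp [Fin.ext_iff, Fin.rev, p0, p1, p2] <;> omega
    have hrange (j : Fin (2 * n + 1)) (hj : j ∉ Set.range p) : j.rev ∉ Set.range p := by
      rintro ⟨a, ha⟩
      exact hj ⟨a.rev, by rw [← hrev, ha, Fin.rev_rev]⟩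
    have hsign (a : Fin 3) : s (p a) * d a.rev = (-1) ^ (n + 1) * (d a * t a) := by
      have h2 : s (p 2) = s (p 0) := by rw [← hsrev, hrev]; rfl
      have h0 : s (p 0) = (-1) ^ i := by simp only [s, p0, Nat.sub_add_cancel hi1]
      fin_cases a
      · change s (p 0) * ε = _ * (1 * -1)
        rw [h0, hε]
        rcases neg_one_pow_eq_or R i with h | h <;> simp [pow_add, h]
      · simp [s, d, t, p1, Fin.rev]
      · change s (p 2) * 1 = _ * (ε * -1)
        rw [h2, h0, hε]
        rcases neg_one_pow_eq_or R n with h | h <;> simp [pow_add, h]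
    symm
    rw [hFe (J3 * B * J3), eq_extendByOne_iff]
    obtain ⟨e1, e2, e3, e4⟩ := (eq_extendByOne_iff p _ _).1 (hFe B)
    refine ⟨fun a b ↦ ?_, fun a k hk ↦ ?_, fun j b hj ↦ ?_, fun j k hj hk ↦ ?_⟩ <;>
      rw [signed_rev_conj_apply s J _ hJ' hsrev]
    · rw [hrev, hrev, e1, mul_diagonal, diagonal_mul, mul_diagonal, diagonal_mul,
        signed_rev_conj_apply t J3 _ hJ3' htrev]
      have hc : ((-1 : R) ^ (n + 1)) * (-1) ^ (n + 1) = 1 := by simp [← mul_pow]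
      linear_combination B a.rev b.rev * (s (p b) * d b.rev * hsign a +
        (-1) ^ (n + 1) * d a * t a * hsign b + d a * t a * d b * t b * hc)
    · rw [hrev, e2 _ _ (hrange k hk), mul_zero]
    · rw [hrev, e3 _ _ (hrange j hj), mul_zero]
    · rw [e4 _ _ (hrange j hj) (hrange k hk)]
      by_cases h : j = k
      · subst h
        simp [hss]
      · simp [h]
end

section
/- Let R be a reduced crystallographic root system in a finite-dimensional real vector space V with base Δ and corresponding positive roots R₊, and let A be a group acting linearly on V by automorphisms of R that preserve Δ. Let E ⊆ R₊ be an A-orbit such that for all α, β ∈ E the sum α + β is not a root. Then for all distinct α, β ∈ E one has ⟨α, β^∨⟩ = 0, and consequently for every α ∈ E the pairing of α against the sum of the coroots of the elements of E equals 2: ⟨α, Σ_{β∈E} β^∨⟩ = 2. -/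
/-- A reduced crystallographic root system in a real vector space `V`. -/
structure IsRootSystem {V : Type*} [AddCommGroup V] [Module ℝ V]
    (R : Set V) (coroot : V → (V →ₗ[ℝ] ℝ)) : Prop where
  finite : R.Finite
  zero_not_mem : (0 : V) ∉ R
  coroot_self : ∀ α ∈ R, coroot α α = 2
  crystallographic : ∀ α ∈ R, ∀ β ∈ R, ∃ z : ℤ, coroot α β = (z : ℝ)
  reflect_mem : ∀ α ∈ R, ∀ β ∈ R, β - coroot α β • α ∈ R
  reduced : ∀ α ∈ R, ∀ t : ℝ, t • α ∈ R → t = 1 ∨ t = -1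

/-- A base `Δ` of the root system `R`. -/
structure IsBase {V : Type*} [AddCommGroup V] [Module ℝ V]
    (R : Set V) (coroot : V → (V →ₗ[ℝ] ℝ)) (Δ : Set V) : Prop where
  subset : Δ ⊆ R
  indep : LinearIndependent ℝ (fun δ : Δ => (δ : V))
  decomp : ∀ α ∈ R,
    (∃ f : V →₀ ℕ, ↑f.support ⊆ Δ ∧ α = f.sum fun δ c => (c : ℝ) • δ) ∨
    (∃ f : V →₀ ℕ, ↑f.support ⊆ Δ ∧ α = -(f.sum fun δ c => (c : ℝ) • δ))

/-- The positive roots of `R` with respect to the base `Δ`. -/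
def posRoots {V : Type*} [AddCommGroup V] [Module ℝ V] (R Δ : Set V) : Set V :=
  {α ∈ R | ∃ f : V →₀ ℕ, ↑f.support ⊆ Δ ∧ α = f.sum fun δ c => (c : ℝ) • δ}

open Module in
/-- Two roots, neither equal nor opposite, are orthogonal if neither their sum nor their difference
is a root. -/
lemma IsRootSystem.coroot_apply_eq_zero {V : Type*} [AddCommGroup V] [Module ℝ V]
    [FiniteDimensional ℝ V] {R : Set V} {coroot : V → (V →ₗ[ℝ] ℝ)} (hR : IsRootSystem R coroot)
    {α β : V} (hα : α ∈ R) (hβ : β ∈ R) (hne : α ≠ β) (hne' : α ≠ -β)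
    (hadd : α + β ∉ R) (hsub : α - β ∉ R) : coroot β α = 0 := by
  let W := Submodule.span ℝ R
  let root : R ↪ W :=
    ⟨fun x ↦ ⟨x, Submodule.subset_span x.2⟩, fun x y h ↦ Subtype.ext (Subtype.mk.inj h)⟩
  have mem_range (w : W) : w ∈ Set.range root ↔ (w : V) ∈ R :=
    ⟨by rintro ⟨x, rfl⟩; exact x.2, fun h ↦ ⟨⟨w, h⟩, rfl⟩⟩
  have : IsAddTorsionFree V := .of_isTorsionFree ℝ V
  have : Finite R := hR.finite
  have mapsTo (x : R) : Set.MapsTo (preReflection x.1 (coroot x)) R R := fun y hy ↦ by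
    simpa [preReflection_apply] using hR.reflect_mem x x.2 y hy
  let co : R ↪ Dual ℝ W := ⟨fun x ↦ (coroot x).domRestrict W, fun x y h ↦ by
    have hxy (w : V) (hw : w ∈ R) : coroot x w = coroot y w :=
      LinearMap.congr_fun h (⟨w, Submodule.subset_span hw⟩ : W)
    exact Subtype.ext <| eq_of_mapsTo_reflection_of_mem hR.finite
      (hR.coroot_self x x.2) (hR.coroot_self y y.2)
      ((hxy x x.2).symm.trans (hR.coroot_self x x.2))
      ((hxy y y.2).trans (hR.coroot_self y y.2)) (mapsTo x) (mapsTo y) y.2⟩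
  let P : RootPairing R ℝ W (Dual ℝ W) := RootPairing.mk'' (Dual.eval ℝ W) root co
    (fun x ↦ hR.coroot_self x x.2)
    (fun x y hy ↦ by
      rw [mem_range] at hy ⊢
      exact mapsTo x hy)
    (by
      rw [show Set.range root = Subtype.val ⁻¹' R from Set.ext mem_range]
      exact Submodule.span_span_coe_preimage)
  have : P.IsCrystallographic := ⟨fun x y ↦ by
    obtain ⟨z, hz⟩ := hR.crystallographic y y.2 x x.2
    exact ⟨z, hz.symm⟩⟩
  exact P.pairing_eq_zero_of_add_notMem_of_sub_notMem (i := ⟨α, hα⟩) (j := ⟨β, hβ⟩)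
    (fun h ↦ hne (congrArg Subtype.val h))
    (fun h ↦ hne' (congrArg Subtype.val h))
    (fun h ↦ hadd ((mem_range _).1 h))
    (fun h ↦ hsub ((mem_range _).1 h))

/-- The height with respect to a linearly independent set, as a linear functional. -/
lemma exists_height {V : Type*} [AddCommGroup V] [Module ℝ V] {Δ : Set V}
    (h : LinearIndependent ℝ (fun δ : Δ => (δ : V))) :
    ∃ ht : V →ₗ[ℝ] ℝ, ∀ δ ∈ Δ, ht δ = 1 := by
  have h' : LinearIndepOn ℝ id Δ := h
  refine ⟨(Module.Basis.extend h').constr ℝ fun _ ↦ (1 : ℝ), fun δ hδ ↦ ?_⟩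
  have := (Module.Basis.extend h').constr_basis ℝ (fun _ ↦ (1 : ℝ)) ⟨δ, h'.subset_extend _ hδ⟩
  simpa using this

lemma eq_zero_of_height_eq_zero {V : Type*} [AddCommGroup V] [Module ℝ V] {Δ : Set V}
    {ht : V →ₗ[ℝ] ℝ} (hht : ∀ δ ∈ Δ, ht δ = 1) {f : V →₀ ℕ} (hf : ↑f.support ⊆ Δ)
    (h : ht (f.sum fun δ c => (c : ℝ) • δ) = 0) : (f.sum fun δ c => (c : ℝ) • δ) = 0 := by
  have hs : ∑ δ ∈ f.support, (f δ : ℝ) = 0 := by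
    rw [← h, Finsupp.sum, map_sum]
    exact Finset.sum_congr rfl fun δ hδ ↦ by simp [hht δ (hf hδ)]
  rw [Finset.sum_eq_zero_iff_of_nonneg (fun _ _ ↦ Nat.cast_nonneg _)] at hs
  exact Finset.sum_eq_zero fun δ hδ ↦ by simp only [hs δ hδ, zero_smul]

lemma IsRootSystem.height_ne_zero {V : Type*} [AddCommGroup V] [Module ℝ V] {R Δ : Set V}
    {coroot : V → (V →ₗ[ℝ] ℝ)} (hR : IsRootSystem R coroot) (hΔ : IsBase R coroot Δ)
    {ht : V →ₗ[ℝ] ℝ} (hht : ∀ δ ∈ Δ, ht δ = 1) {α : V} (hα : α ∈ R) : ht α ≠ 0 := by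
  intro h
  apply hR.zero_not_mem
  obtain ⟨f, hf, rfl⟩ | ⟨f, hf, rfl⟩ := hΔ.decomp α hα
  · rwa [eq_zero_of_height_eq_zero hht hf h] at hα
  · rw [map_neg, neg_eq_zero] at h
    rwa [eq_zero_of_height_eq_zero hht hf h, neg_zero] at hα

lemma height_apply_eq {V : Type*} [AddCommGroup V] [Module ℝ V] {R Δ : Set V}
    {ht : V →ₗ[ℝ] ℝ} (hht : ∀ δ ∈ Δ, ht δ = 1) {g : V ≃ₗ[ℝ] V} (hg : ⇑g '' Δ = Δ)
    {α : V} (hα : α ∈ posRoots R Δ) : ht (g α) = ht α := by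
  obtain ⟨-, f, hf, rfl⟩ := hα
  simp only [Finsupp.sum, map_sum, map_smul]
  refine Finset.sum_congr rfl fun δ hδ ↦ ?_
  rw [hht δ (hf hδ), hht (g δ) (hg ▸ Set.mem_image_of_mem g (hf hδ))]

/-- Let `R` be a reduced crystallographic root system in a finite-dimensional
real vector space `V` with base `Δ` and positive roots `posRoots R Δ`, and let the group `A` act
on `V` (via `ρ`) by automorphisms of `R` preserving `Δ`. Let `E` be an `A`-orbit of positive
roots such that no sum of two elements of `E` is a root. Then `⟨α, β^∨⟩ = 0` for all distinct
`α, β ∈ E`, and consequently `⟨α, Σ_{β ∈ E} β^∨⟩ = 2` for every `α ∈ E`. -/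
theorem stmt_13 {V A : Type*} [AddCommGroup V] [Module ℝ V] [FiniteDimensional ℝ V] [Group A]
    (R Δ : Set V) (coroot : V → (V →ₗ[ℝ] ℝ))
    (hR : IsRootSystem R coroot) (hΔ : IsBase R coroot Δ)
    (ρ : A →* (V ≃ₗ[ℝ] V))
    (hρR : ∀ a : A, ⇑(ρ a) '' R = R) (hρΔ : ∀ a : A, ⇑(ρ a) '' Δ = Δ)
    (E : Set V) (hEpos : E ⊆ posRoots R Δ)
    (hEorb : ∃ α₀ ∈ posRoots R Δ, E = Set.range fun a : A => ρ a α₀)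
    (hsum : ∀ α ∈ E, ∀ β ∈ E, α + β ∉ R) :
    (∀ α ∈ E, ∀ β ∈ E, α ≠ β → coroot β α = 0) ∧
    (∀ α ∈ E, ∑ᶠ β ∈ E, coroot β α = 2) := by
  obtain ⟨ht, hht⟩ := exists_height hΔ.indep
  obtain ⟨α₀, hα₀, rfl⟩ := hEorb
  have height_eq : ∀ α ∈ Set.range (fun a : A => ρ a α₀), ht α = ht α₀ := by
    rintro - ⟨a, rfl⟩
    exact height_apply_eq hht (hρΔ a) hα₀
  have orth : ∀ α ∈ Set.range (fun a : A => ρ a α₀), ∀ β ∈ Set.range (fun a : A => ρ a α₀),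
      α ≠ β → coroot β α = 0 := by
    intro α hα β hβ hne
    refine hR.coroot_apply_eq_zero (hEpos hα).1 (hEpos hβ).1 hne ?_ (hsum α hα β hβ) fun h ↦ ?_
    · intro h
      apply hR.height_ne_zero hΔ hht (hEpos hα).1
      have := congrArg ht h
      rw [map_neg, height_eq β hβ, ← height_eq α hα] at this
      linarith
    · apply hR.height_ne_zero hΔ hht h
      rw [map_sub, height_eq α hα, height_eq β hβ, sub_self]
  refine ⟨orth, fun α hα ↦ ?_⟩
  refine (finsum_eq_single _ α fun β hne ↦ ?_).trans ?_
  · exact (finsum_congr fun hβ ↦ orth α hα β hβ hne.symm).trans finsum_zero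
  · simpa only [hα, finsum_true] using hR.coroot_self α (hEpos hα).1
end

section
/- Let R be a reduced crystallographic root system in a finite-dimensional real vector space V with base Δ and positive roots R₊, and let A be a group acting linearly on V by automorphisms of R preserving Δ. Define α ∼ β on R₊ to mean that Σ_{γ ∈ A·α} γ and Σ_{δ ∈ A·β} δ are real scalar multiples of one another. Then every equivalence class E of ∼ has one of the following two forms: (i) E is a single A-orbit, and for all α, β ∈ E the sum α + β is not a root; or (ii) there exist α ∈ R₊ and a ∈ A such that α + a·α is a root, and E is the disjoint union of the A-orbit of α and the A-orbit of α + a·α. -/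
/-- The sum of the `A`-orbit of `α` under the action `ρ`. -/
noncomputable def orbitSum {V A : Type*} [AddCommGroup V] [Module ℝ V] [Group A]
    (ρ : A →* (V ≃ₗ[ℝ] V)) (α : V) : V :=
  ∑ᶠ v ∈ Set.range (fun a : A => ρ a α), v

/-- The equivalence relation `∼` on positive roots: `α ∼ β` iff the orbit sums of `α` and `β`
are real scalar multiples of one another. -/
def sim {V A : Type*} [AddCommGroup V] [Module ℝ V] [Group A]
    (ρ : A →* (V ≃ₗ[ℝ] V)) (α β : V) : Prop :=
  (∃ c : ℝ, orbitSum ρ α = c • orbitSum ρ β) ∨ (∃ c : ℝ, orbitSum ρ β = c • orbitSum ρ α)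

section Roots

open Submodule

/-- A symmetric bilinear form which is positive definite on the span of `R` and invariant there
under every linear automorphism preserving `R`. -/
structure IsInvariantForm {V : Type*} [AddCommGroup V] [Module ℝ V]
    (R : Set V) (B : LinearMap.BilinForm ℝ V) : Prop where
  symm : ∀ x y, B x y = B y x
  pos : ∀ x ∈ span ℝ R, x ≠ 0 → 0 < B x x
  map_map : ∀ g : V ≃ₗ[ℝ] V, (∀ x ∈ R, g x ∈ R) →
    ∀ x ∈ span ℝ R, ∀ y ∈ span ℝ R, B (g x) (g y) = B x y

theorem exists_isInvariantForm {V : Type*} [AddCommGroup V] [Module ℝ V] [FiniteDimensional ℝ V]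
    {R : Set V} (hR : R.Finite) : ∃ B : LinearMap.BilinForm ℝ V, IsInvariantForm R B := by
  classical
  have : Fintype R := hR.fintype
  let b := Module.finBasis ℝ V
  let S : Finset (Equiv.Perm R) :=
    Finset.univ.filter fun σ => ∃ g : V ≃ₗ[ℝ] V, ∀ r : R, g r = σ r
  let G : Equiv.Perm R → (V ≃ₗ[ℝ] V) := fun σ =>
    if h : ∃ g : V ≃ₗ[ℝ] V, ∀ r : R, g r = σ r then h.choose else LinearEquiv.refl ℝ V
  have hG : ∀ σ ∈ S, ∀ r : R, G σ r = σ r := by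
    intro σ hσ
    have h := (Finset.mem_filter.1 hσ).2
    simp only [G, dif_pos h]
    exact h.choose_spec
  let B : LinearMap.BilinForm ℝ V := ∑ σ ∈ S, ∑ i,
    LinearMap.BilinForm.linMulLin (b.coord i ∘ₗ (G σ : V →ₗ[ℝ] V))
      (b.coord i ∘ₗ (G σ : V →ₗ[ℝ] V))
  have hB : ∀ x y, B x y = ∑ σ ∈ S, ∑ i, b.repr (G σ x) i * b.repr (G σ y) i := by
    intro x y
    simp [B, LinearMap.sum_apply]
  have hone : (1 : Equiv.Perm R) ∈ S :=
    Finset.mem_filter.2 ⟨Finset.mem_univ _, LinearEquiv.refl ℝ V, fun r => by simp⟩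
  refine ⟨B, fun x y => ?_, fun x _ hx0 => ?_, fun g hg x hx y hy => ?_⟩
  · rw [hB, hB]
    exact Finset.sum_congr rfl fun _ _ => Finset.sum_congr rfl fun _ _ => mul_comm _ _
  · rw [hB]
    refine Finset.sum_pos (fun σ _ => ?_) ⟨1, hone⟩
    obtain ⟨i, hi⟩ : ∃ i, b.repr (G σ x) i ≠ 0 := by
      by_contra! h
      have : b.repr (G σ x) = 0 := Finsupp.ext h
      simp [hx0] at this
    exact Finset.sum_pos' (fun j _ => mul_self_nonneg _)
      ⟨i, Finset.mem_univ _, mul_self_pos.2 hi⟩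
  · have hinj : Function.Injective fun r : R => (⟨g r, hg r r.2⟩ : R) := by
      intro r s hrs
      simpa [Subtype.ext_iff] using hrs
    let τ : Equiv.Perm R := Equiv.ofBijective _ (Finite.injective_iff_bijective.1 hinj)
    have hτ : ∀ r : R, ((τ r : R) : V) = g r := fun r => rfl
    have hmem : ∀ σ, σ ∈ S ↔ σ * τ ∈ S := by
      intro σ
      constructor
      · intro hσ
        refine Finset.mem_filter.2 ⟨Finset.mem_univ _, g.trans (G σ), fun r => ?_⟩
        simp [← hτ, hG σ hσ]
      · intro hσ
        refine Finset.mem_filter.2 ⟨Finset.mem_univ _, g.symm.trans (G (σ * τ)), fun r => ?_⟩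
        have h1 : g.symm (r : V) = τ.symm r := by
          rw [LinearEquiv.symm_apply_eq, ← hτ, Equiv.apply_symm_apply]
        simp [h1, hG _ hσ]
    have hagree : ∀ σ ∈ S, ∀ z ∈ span ℝ R, G σ (g z) = G (σ * τ) z := by
      intro σ hσ z hz
      have : Set.EqOn ((G σ : V →ₗ[ℝ] V) ∘ₗ (g : V →ₗ[ℝ] V)) (G (σ * τ) : V →ₗ[ℝ] V) R := by
        intro r hr
        have h1 := hG _ ((hmem σ).1 hσ) ⟨r, hr⟩
        have h2 := hG σ hσ (τ ⟨r, hr⟩)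
        simpa [h1, hτ] using h2
      exact LinearMap.eqOn_span this hz
    rw [hB, hB]
    refine Finset.sum_equiv (Equiv.mulRight τ) (fun σ => hmem σ) fun σ hσ => ?_
    simp [hagree σ hσ x hx, hagree σ hσ y hy]

variable {V : Type*} [AddCommGroup V] [Module ℝ V] {R : Set V} {coroot : V → (V →ₗ[ℝ] ℝ)}
  {B : LinearMap.BilinForm ℝ V}

theorem IsRootSystem.neg_mem (hR : IsRootSystem R coroot) {α : V} (hα : α ∈ R) : -α ∈ R := by
  have h := hR.reflect_mem α hα α hα
  rw [hR.coroot_self α hα] at h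
  convert h using 1
  module

theorem IsRootSystem.add_self_notMem (hR : IsRootSystem R coroot) {α : V} (hα : α ∈ R) :
    α + α ∉ R := by
  intro h
  rw [← two_smul ℝ] at h
  rcases hR.reduced α hα 2 h with h | h <;> norm_num at h

theorem IsInvariantForm.root_pos (hB : IsInvariantForm R B) (hR : IsRootSystem R coroot)
    {α : V} (hα : α ∈ R) : 0 < B α α :=
  hB.pos α (subset_span hα) fun h => hR.zero_not_mem (h ▸ hα)

theorem IsInvariantForm.coroot_mul (hB : IsInvariantForm R B) (hR : IsRootSystem R coroot)
    {α β : V} (hα : α ∈ R) (hβ : β ∈ R) : coroot α β * B α α = 2 * B β α := by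
  have hself := hR.coroot_self α hα
  let s : V ≃ₗ[ℝ] V := Module.reflection hself
  have hs : ∀ x, s x = x - coroot α x • α := fun x => Module.reflection_apply x hself
  have h := hB.map_map s (fun x hx => by rw [hs]; exact hR.reflect_mem α hα x hx)
    β (subset_span hβ) α (subset_span hα)
  rw [hs, hs, hself] at h
  simp only [map_sub, map_smul, LinearMap.sub_apply, LinearMap.smul_apply, smul_eq_mul] at h
  linarith

/-- Two distinct roots forming an acute angle have a root as their difference. -/
theorem IsInvariantForm.sub_mem (hB : IsInvariantForm R B) (hR : IsRootSystem R coroot)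
    {α β : V} (hα : α ∈ R) (hβ : β ∈ R) (hne : α ≠ β) (h : 0 < B α β) : α - β ∈ R := by
  have h1 := hB.coroot_mul hR hα hβ
  have h2 := hB.coroot_mul hR hβ hα
  rw [hB.symm β α] at h1
  have pα := hB.root_pos hR hα
  have pβ := hB.root_pos hR hβ
  obtain ⟨y, hy⟩ := hR.crystallographic α hα β hβ
  obtain ⟨z, hz⟩ := hR.crystallographic β hβ α hα
  have hy0 : 0 < y := by
    have : 0 < coroot α β := pos_of_mul_pos_left (by linarith) pα.le
    rw [hy] at this; exact_mod_cast this
  have hz0 : 0 < z := by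
    have : 0 < coroot β α := pos_of_mul_pos_left (by linarith) pβ.le
    rw [hz] at this; exact_mod_cast this
  by_cases hz1 : z = 1
  · have := hR.reflect_mem β hβ α hα
    simpa [hz, hz1] using this
  by_cases hy1 : y = 1
  · have := hR.neg_mem (hR.reflect_mem α hα β hβ)
    simpa [hy, hy1] using this
  exfalso
  have hy2 : (2 : ℝ) ≤ y := by exact_mod_cast (by omega : 2 ≤ y)
  have hz2 : (2 : ℝ) ≤ z := by exact_mod_cast (by omega : 2 ≤ z)
  rw [hy] at h1
  rw [hz] at h2
  have := hB.pos (α - β) (Submodule.sub_mem _ (subset_span hα) (subset_span hβ)) (sub_ne_zero.2 hne)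
  simp only [map_sub, LinearMap.sub_apply, hB.symm β α] at this
  nlinarith

/-- Two distinct roots forming an obtuse angle, not opposite, have a root as their sum. -/
theorem IsInvariantForm.add_mem (hB : IsInvariantForm R B) (hR : IsRootSystem R coroot)
    {α β : V} (hα : α ∈ R) (hβ : β ∈ R) (hne : α + β ≠ 0) (h : B α β < 0) : α + β ∈ R := by
  have := hB.sub_mem hR hα (hR.neg_mem hβ) (fun h => hne (by rw [h]; simp))
    (by rw [map_neg]; linarith)
  simpa using this

/-- For roots of the same length that are not opposite, an obtuse angle is `2π / 3`. -/
theorem IsInvariantForm.coroot_eq_neg_one (hB : IsInvariantForm R B)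
    (hR : IsRootSystem R coroot) {α β : V} (hα : α ∈ R) (hβ : β ∈ R) (hne : α + β ≠ 0)
    (hlen : B β β = B α α) (h : B α β < 0) : coroot α β = -1 := by
  have h1 := hB.coroot_mul hR hα hβ
  have pα := hB.root_pos hR hα
  have hadd := hB.pos (α + β) (Submodule.add_mem _ (subset_span hα) (subset_span hβ)) hne
  simp only [map_add, LinearMap.add_apply] at hadd
  rw [hB.symm β α] at h1 hadd
  obtain ⟨y, hy⟩ := hR.crystallographic α hα β hβ
  rw [hy] at h1 ⊢
  have hlt : (y : ℝ) < 0 := by nlinarith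
  have hgt : (-2 : ℝ) < y := by nlinarith
  have : y < 0 := by exact_mod_cast hlt
  have : -2 < y := by exact_mod_cast hgt
  have : y = -1 := by omega
  simp [this]

/-- In a finite set of roots of the same length with pairwise non-acute angles, every element
forms an obtuse angle with at most one other, provided its product with the sum is positive. -/
theorem IsInvariantForm.eq_of_obtuse (hB : IsInvariantForm R B) (hR : IsRootSystem R coroot)
    {O : Finset V} (hO : ∀ γ ∈ O, γ ∈ R) (hlen : ∀ γ ∈ O, ∀ δ ∈ O, B γ γ = B δ δ)
    (hne : ∀ γ ∈ O, ∀ δ ∈ O, γ + δ ≠ 0) (hle : ∀ γ ∈ O, ∀ δ ∈ O, γ ≠ δ → B γ δ ≤ 0)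
    (hsum : ∀ γ ∈ O, 0 < ∑ v ∈ O, B γ v) {γ δ ε : V} (hγ : γ ∈ O) (hδ : δ ∈ O) (hε : ε ∈ O)
    (h1 : B γ δ < 0) (h2 : B γ ε < 0) : δ = ε := by
  classical
  by_contra hδε
  have pγ := hB.root_pos hR (hO γ hγ)
  have key : ∀ v ∈ O, B γ v < 0 → γ ≠ v ∧ 2 * B γ v = -B γ γ := by
    intro v hv h
    have c := hB.coroot_mul hR (hO γ hγ) (hO v hv)
    rw [hB.coroot_eq_neg_one hR (hO γ hγ) (hO v hv) (hne γ hγ v hv) (hlen v hv γ hγ) h,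
      hB.symm v γ] at c
    exact ⟨by rintro rfl; linarith, by linarith⟩
  obtain ⟨hγδ, e1⟩ := key δ hδ h1
  obtain ⟨hγε, e2⟩ := key ε hε h2
  have hsub : ({γ, δ, ε} : Finset V) ⊆ O := by
    intro v hv
    simp only [Finset.mem_insert, Finset.mem_singleton] at hv
    rcases hv with rfl | rfl | rfl <;> assumption
  have hs := hsum γ hγ
  rw [← Finset.sum_sdiff hsub, Finset.sum_insert (by simp [hγδ, hγε]),
    Finset.sum_pair hδε] at hs
  have : ∑ v ∈ O \ {γ, δ, ε}, B γ v ≤ 0 := Finset.sum_nonpos fun v hv => by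
    simp only [Finset.mem_sdiff, Finset.mem_insert, not_or] at hv
    exact hle γ hγ v hv.1 (Ne.symm hv.2.1)
  linarith

/-- The structure of the set of positive roots in a stable subspace `K` whose elements all form
an acute angle with the sum of the orbit of an element `α₀` of least height. -/
theorem IsInvariantForm.orbit_dichotomy {A : Type*} [Group A] (hB : IsInvariantForm R B)
    (hR : IsRootSystem R coroot) {ρ : A →* (V ≃ₗ[ℝ] V)} (hρ : ∀ a, ∀ α ∈ R, ρ a α ∈ R)
    {ht : V →ₗ[ℝ] ℝ} (ht0 : ∀ α ∈ R, ht α ≠ 0) (htρ : ∀ a, ∀ α ∈ R, ht (ρ a α) = ht α)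
    {K : Submodule ℝ V} (hK : ∀ a, ∀ α ∈ R, α ∈ K → ρ a α ∈ K) {E : Set V}
    (hE : ∀ β, β ∈ E ↔ β ∈ R ∧ β ∈ K ∧ 0 < ht β) {α₀ : V} (hα₀ : α₀ ∈ E)
    (hmin : ∀ β ∈ E, ht α₀ ≤ ht β) {O : Finset V}
    (hO : ∀ v, v ∈ O ↔ v ∈ Set.range fun a => ρ a α₀)
    (hsum : ∀ β ∈ E, 0 < ∑ v ∈ O, B β v) :
    ((E = Set.range fun a => ρ a α₀) ∧ ∀ α ∈ E, ∀ β ∈ E, α + β ∉ R) ∨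
    (∃ α ∈ E, ∃ a : A, α + ρ a α ∈ R ∧
      E = (Set.range fun b : A => ρ b α) ∪ (Set.range fun b : A => ρ b (α + ρ a α)) ∧
      Disjoint (Set.range fun b : A => ρ b α)
        (Set.range fun b : A => ρ b (α + ρ a α))) := by
  have hER : ∀ β ∈ E, β ∈ R := fun β h => ((hE β).1 h).1
  have hEK : ∀ β ∈ E, β ∈ K := fun β h => ((hE β).1 h).2.1
  have hEpos : ∀ β ∈ E, 0 < ht β := fun β h => ((hE β).1 h).2.2
  have hEρ : ∀ a, ∀ β ∈ E, ρ a β ∈ E := fun a β h =>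
    (hE _).2 ⟨hρ a β (hER β h), hK a β (hER β h) (hEK β h), by
      rw [htρ a β (hER β h)]; exact hEpos β h⟩
  have hBρ : ∀ a, ∀ α ∈ R, ∀ β ∈ R, B (ρ a α) (ρ a β) = B α β := fun a α hα β hβ =>
    hB.map_map (ρ a) (hρ a) α (subset_span hα) β (subset_span hβ)
  have hOE : ∀ γ ∈ O, γ ∈ E := by
    intro γ hγ
    obtain ⟨a, rfl⟩ := (hO γ).1 hγ
    exact hEρ a α₀ hα₀
  have hOht : ∀ γ ∈ O, ht γ = ht α₀ := by
    intro γ hγ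
    obtain ⟨a, rfl⟩ := (hO γ).1 hγ
    exact htρ a α₀ (hER _ hα₀)
  have hOlen : ∀ γ ∈ O, ∀ δ ∈ O, B γ γ = B δ δ := by
    have : ∀ γ ∈ O, B γ γ = B α₀ α₀ := by
      intro γ hγ
      obtain ⟨a, rfl⟩ := (hO γ).1 hγ
      exact hBρ a α₀ (hER _ hα₀) α₀ (hER _ hα₀)
    intro γ hγ δ hδ
    rw [this γ hγ, this δ hδ]
  have hOR : ∀ γ ∈ O, γ ∈ R := fun γ hγ => hER γ (hOE γ hγ)
  have hm := hEpos α₀ hα₀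
  have hOρ : ∀ a, ∀ γ ∈ O, ρ a γ ∈ O := by
    intro a γ hγ
    obtain ⟨b, rfl⟩ := (hO γ).1 hγ
    exact (hO _).2 ⟨a * b, by simp⟩
  have hOtrans : ∀ γ ∈ O, ∀ δ ∈ O, ∃ a, ρ a γ = δ := by
    intro γ hγ δ hδ
    obtain ⟨b, rfl⟩ := (hO γ).1 hγ
    obtain ⟨c, rfl⟩ := (hO δ).1 hδ
    exact ⟨c * b⁻¹, by simp [← LinearEquiv.mul_apply, ← map_mul]⟩
  have hne : ∀ γ ∈ O, ∀ δ ∈ O, γ + δ ≠ 0 := by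
    intro γ hγ δ hδ h
    have := congrArg ht h
    rw [map_add, hOht γ hγ, hOht δ hδ, map_zero] at this
    linarith
  have hdiff : ∀ γ ∈ O, ∀ δ ∈ O, γ - δ ∉ R := by
    intro γ hγ δ hδ h
    exact ht0 _ h (by rw [map_sub, hOht γ hγ, hOht δ hδ, sub_self])
  have hle : ∀ γ ∈ O, ∀ δ ∈ O, γ ≠ δ → B γ δ ≤ 0 := by
    intro γ hγ δ hδ h
    by_contra! hpos
    exact hdiff γ hγ δ hδ (hB.sub_mem hR (hOR γ hγ) (hOR δ hδ) h hpos)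
  have hdesc : ∀ β ∈ E, β ∉ O → ∃ γ ∈ O, β - γ ∈ E := by
    intro β hβ hβO
    obtain ⟨γ, hγ, hpos⟩ := Finset.exists_lt_of_sum_lt
      (by simpa using hsum β hβ : ∑ v ∈ O, (0 : ℝ) < ∑ v ∈ O, B β v)
    have hmem := hB.sub_mem hR (hER β hβ) (hOR γ hγ) (fun h => hβO (h ▸ hγ)) hpos
    have hK' := K.sub_mem (hEK β hβ) (hEK γ (hOE γ hγ))
    refine ⟨γ, hγ, (hE _).2 ⟨hmem, hK', ?_⟩⟩
    refine lt_of_le_of_ne ?_ (Ne.symm (ht0 _ hmem))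
    rw [map_sub, hOht γ hγ]
    linarith [hmin β hβ]
  have hsumneg : ∀ γ ∈ O, ∀ δ ∈ O, γ + δ ∈ R → B γ δ < 0 := by
    intro γ hγ δ hδ h
    have hγδ : γ ≠ δ := by
      rintro rfl
      exact hR.add_self_notMem (hOR γ hγ) h
    refine lt_of_le_of_ne (hle γ hγ δ hδ hγδ) fun h0 => hdiff γ hγ δ hδ ?_
    have hc := hB.coroot_mul hR (hOR δ hδ) (hOR γ hγ)
    rw [h0, mul_zero, mul_eq_zero, or_iff_left (hB.root_pos hR (hOR δ hδ)).ne'] at hc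
    have := hR.reflect_mem δ (hOR δ hδ) _ h
    rw [map_add, hc, hR.coroot_self δ (hOR δ hδ)] at this
    convert this using 1
    module
  have huniq : ∀ γ ∈ O, ∀ δ ∈ O, ∀ ε ∈ O, B γ δ < 0 → B γ ε < 0 → δ = ε :=
    fun γ hγ δ hδ ε hε => hB.eq_of_obtuse hR hOR hOlen hne hle
      (fun v hv => hsum v (hOE v hv)) hγ hδ hε
  have hEfin : E.Finite := hR.finite.subset hER
  have hOsub : (Set.range fun a => ρ a α₀) ⊆ E := fun v hv => hOE v ((hO v).2 hv)
  by_cases hadd : ∃ γ ∈ O, ∃ δ ∈ O, γ + δ ∈ R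
  · right
    obtain ⟨α, hα, α', hα', hαα'⟩ := hadd
    obtain ⟨a, rfl⟩ := hOtrans α hα α' hα'
    have hαneg := hsumneg _ hα _ hα' hαα'
    have hαE : α + ρ a α ∈ E := (hE _).2 ⟨hαα', K.add_mem (hEK _ (hOE _ hα))
      (hEK _ (hOE _ hα')), by rw [map_add, hOht _ hα, hOht _ hα']; linarith⟩
    have hOα : ∀ v, v ∈ O ↔ v ∈ Set.range fun b => ρ b α := by
      intro v
      refine ⟨fun hv => hOtrans α hα v hv, ?_⟩
      rintro ⟨b, rfl⟩
      exact hOρ b α hα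
    have hO2 : ∀ γ ∈ O, ∀ δ ∈ O, γ + δ ∈ R →
        γ + δ ∈ Set.range fun b => ρ b (α + ρ a α) := by
      intro γ hγ δ hδ h
      obtain ⟨c, rfl⟩ := hOtrans α hα γ hγ
      refine ⟨c, ?_⟩
      have hc : B (ρ c α) (ρ c (ρ a α)) < 0 := by
        rwa [hBρ c _ (hOR _ hα) _ (hOR _ hα')]
      have := huniq _ hγ _ (hOρ c _ hα') _ hδ hc (hsumneg _ hγ _ hδ h)
      simp [this]
    -- the sum of `γ` with a root of the second orbit involving `γ` is not a root
    have hsame : ∀ γ ∈ O, ∀ δ ∈ O, B γ δ < 0 → γ + (γ + δ) ∉ R := by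
      intro γ hγ δ hδ hneg h
      have hc := hB.coroot_eq_neg_one hR (hOR γ hγ) (hOR δ hδ) (hne γ hγ δ hδ)
        (hOlen δ hδ γ hγ) hneg
      have := hR.reflect_mem γ (hOR γ hγ) _ h
      rw [map_add, map_add, hc, hR.coroot_self γ (hOR γ hγ)] at this
      refine hdiff δ hδ γ hγ ?_
      convert this using 1
      module
    have hthree : ∀ γ ∈ O, ∀ δ ∈ O, ∀ ε ∈ O, B δ ε < 0 → γ + (δ + ε) ∉ R := by
      intro γ hγ δ hδ ε hε hneg h
      have hneg' : B ε δ < 0 := by rwa [hB.symm]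
      by_cases hγδ : γ = δ
      · subst hγδ
        exact hsame γ hγ ε hε hneg h
      by_cases hγε : γ = ε
      · subst hγε
        rw [add_comm δ γ] at h
        exact hsame γ hγ δ hδ hneg' h
      have h1 : B δ γ = 0 := by
        by_contra h0
        exact hγε (huniq δ hδ γ hγ ε hε
          (lt_of_le_of_ne (hle δ hδ γ hγ (Ne.symm hγδ)) h0) hneg)
      have h2 : B ε γ = 0 := by
        by_contra h0
        exact hγδ (huniq ε hε γ hγ δ hδ
          (lt_of_le_of_ne (hle ε hε γ hγ (Ne.symm hγε)) h0) hneg')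
      have pγ := hB.root_pos hR (hOR γ hγ)
      have c1 := hB.coroot_mul hR (hOR γ hγ) (hOR δ hδ)
      have c2 := hB.coroot_mul hR (hOR γ hγ) (hOR ε hε)
      rw [h1, mul_zero, mul_eq_zero, or_iff_left pγ.ne'] at c1
      rw [h2, mul_zero, mul_eq_zero, or_iff_left pγ.ne'] at c2
      have hmem := hR.reflect_mem γ (hOR γ hγ) _ h
      rw [map_add, map_add, c1, c2, hR.coroot_self γ (hOR γ hγ)] at hmem
      have hmem' : δ + ε - γ ∈ R := by
        convert hmem using 1
        module
      have hht : ht (δ + ε - γ) = ht α₀ := by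
        rw [map_sub, map_add, hOht δ hδ, hOht ε hε, hOht γ hγ]
        ring
      have hηE : δ + ε - γ ∈ E := (hE _).2 ⟨hmem', K.sub_mem
        (K.add_mem (hEK _ (hOE _ hδ)) (hEK _ (hOE _ hε))) (hEK _ (hOE _ hγ)), by rwa [hht]⟩
      have hηO : δ + ε - γ ∈ O := by
        by_contra hη
        obtain ⟨ζ, hζ, hζE⟩ := hdesc _ hηE hη
        have := hEpos _ hζE
        rw [map_sub, hht, hOht ζ hζ, sub_self] at this
        exact this.false
      have hp := hB.pos _ (Submodule.add_mem _ (subset_span (hOR _ hηO))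
        (subset_span (hOR _ hγ))) (hne _ hηO _ hγ)
      have e := hOlen _ hηO _ hγ
      simp only [map_add, map_sub, LinearMap.add_apply, LinearMap.sub_apply, hB.symm γ δ,
        hB.symm γ ε, h1, h2] at hp e
      linarith
    refine ⟨α, hOE α hα, a, hαα', ?_, ?_⟩
    · refine Set.Subset.antisymm ?_ ?_
      · by_contra hnot
        obtain ⟨β, ⟨hβE, hβ⟩, hβmin⟩ := Set.exists_min_image _ ht
          (hEfin.subset Set.sdiff_subset) (Set.sdiff_nonempty.2 hnot)
        simp only [Set.mem_union, not_or, ← hOα] at hβ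
        obtain ⟨γ, hγ, hγE⟩ := hdesc β hβE hβ.1
        have hsub : β - γ ∈ O ∨ β - γ ∈ Set.range fun b => ρ b (α + ρ a α) := by
          by_contra h
          have := hβmin (β - γ) ⟨hγE, by rwa [Set.mem_union, ← hOα]⟩
          rw [map_sub, hOht γ hγ] at this
          linarith
        have hβγ : β = γ + (β - γ) := by module
        rcases hsub with h | ⟨b, h⟩
        · apply hβ.2
          rw [hβγ]
          exact hO2 _ hγ _ h (hβγ ▸ hER β hβE)
        · refine hthree γ hγ (ρ b α) (hOρ b _ hα) (ρ b (ρ a α)) (hOρ b _ hα') ?_ ?_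
          · rwa [hBρ b _ (hOR _ hα) _ (hOR _ hα')]
          · rw [← map_add]
            have h' : ρ b (α + ρ a α) = β - γ := h
            rw [h', ← hβγ]
            exact hER β hβE
      · rintro v (⟨b, rfl⟩ | ⟨b, rfl⟩)
        · exact hEρ b α (hOE α hα)
        · exact hEρ b _ hαE
    · rw [Set.disjoint_left]
      rintro _ ⟨b, rfl⟩ ⟨c, h⟩
      have := congrArg ht h
      simp only [] at this
      rw [htρ c _ hαα', htρ b _ (hOR α hα), map_add, hOht _ hα, hOht _ hα'] at this
      linarith
  · left
    push Not at hadd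
    have hEO : E = Set.range fun a => ρ a α₀ := by
      refine Set.Subset.antisymm ?_ hOsub
      by_contra hnot
      obtain ⟨β, ⟨hβE, hβ⟩, hβmin⟩ := Set.exists_min_image _ ht
        (hEfin.subset Set.sdiff_subset) (Set.sdiff_nonempty.2 hnot)
      rw [← hO] at hβ
      obtain ⟨γ, hγ, hγE⟩ := hdesc β hβE hβ
      have hsub : β - γ ∈ O := by
        by_contra h
        have := hβmin (β - γ) ⟨hγE, by rwa [← hO]⟩
        rw [map_sub, hOht γ hγ] at this
        linarith
      exact hadd _ hsub _ hγ (by simpa using hER β hβE)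
    refine ⟨hEO, fun α hα β hβ => hadd α ?_ β ?_⟩
    · rwa [hO, ← hEO]
    · rwa [hO, ← hEO]

theorem IsBase.exists_height {Δ : Set V} (hR : IsRootSystem R coroot)
    (hΔ : IsBase R coroot Δ) : ∃ ht : V →ₗ[ℝ] ℝ, (∀ δ ∈ Δ, ht δ = 1) ∧
      (∀ α ∈ R, ht α ≠ 0) ∧ ∀ α ∈ R, α ∈ posRoots R Δ ↔ 0 < ht α := by
  have hli : LinearIndepOn ℝ id Δ := hΔ.indep
  let b := Module.Basis.extend hli
  let ht : V →ₗ[ℝ] ℝ := b.constr ℝ fun _ => (1 : ℝ)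
  have ht1 : ∀ δ ∈ Δ, ht δ = 1 := by
    intro δ hδ
    have h := b.constr_basis ℝ (fun _ => (1 : ℝ)) ⟨δ, hli.subset_extend _ hδ⟩
    rwa [Module.Basis.extend_apply_self] at h
  have hcomb : ∀ f : V →₀ ℕ, ↑f.support ⊆ Δ → (f.sum fun δ c => (c : ℝ) • δ) ≠ 0 →
      0 < ht (f.sum fun δ c => (c : ℝ) • δ) := by
    intro f hf h0
    have hval : ht (f.sum fun δ c => (c : ℝ) • δ) = ∑ δ ∈ f.support, (f δ : ℝ) := by
      rw [Finsupp.sum, map_sum]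
      refine Finset.sum_congr rfl fun δ hδ => ?_
      rw [map_smul, ht1 δ (hf hδ), smul_eq_mul, mul_one]
    rw [hval]
    refine Finset.sum_pos (fun δ hδ => ?_) ?_
    · exact_mod_cast Nat.pos_of_ne_zero (Finsupp.mem_support_iff.1 hδ)
    · rw [Finsupp.support_nonempty_iff]
      rintro rfl
      simp at h0
  have hpos : ∀ α ∈ posRoots R Δ, 0 < ht α := by
    rintro α ⟨hα, f, hf, rfl⟩
    exact hcomb f hf fun h => hR.zero_not_mem (h ▸ hα)
  have hneg : ∀ α ∈ R, α ∉ posRoots R Δ → ht α < 0 := by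
    intro α hα hα'
    rcases hΔ.decomp α hα with h | ⟨f, hf, rfl⟩
    · exact absurd ⟨hα, h⟩ hα'
    · rw [map_neg, neg_lt_zero]
      exact hcomb f hf fun h => hR.zero_not_mem (by simpa [h] using hα)
  refine ⟨ht, ht1, fun α hα => ?_, fun α hα => ⟨hpos α, fun h => ?_⟩⟩
  · by_cases h : α ∈ posRoots R Δ
    · exact (hpos α h).ne'
    · exact (hneg α hα h).ne
  · by_contra h'
    exact (hneg α hα h').not_gt h

theorem IsBase.subset_span {Δ : Set V} (hΔ : IsBase R coroot Δ) : R ⊆ span ℝ Δ := by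
  have hcomb : ∀ f : V →₀ ℕ, ↑f.support ⊆ Δ →
      (f.sum fun δ c => (c : ℝ) • δ) ∈ span ℝ Δ := fun f hf =>
    Submodule.sum_mem _ fun δ hδ => Submodule.smul_mem _ _ (Submodule.subset_span (hf hδ))
  intro α hα
  rcases hΔ.decomp α hα with ⟨f, hf, rfl⟩ | ⟨f, hf, rfl⟩
  · exact hcomb f hf
  · exact Submodule.neg_mem _ (hcomb f hf)

section Orbits

variable {A : Type*} [Group A] {ρ : A →* (V ≃ₗ[ℝ] V)}

theorem exists_orbit_finset (hfin : R.Finite) (hρ : ∀ a, ∀ α ∈ R, ρ a α ∈ R) {α : V}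
    (hα : α ∈ R) : ∃ O : Finset V, (∀ v, v ∈ O ↔ v ∈ Set.range fun a => ρ a α) ∧
      orbitSum ρ α = ∑ v ∈ O, v := by
  have h : (Set.range fun a => ρ a α).Finite := hfin.subset (by
    rintro _ ⟨a, rfl⟩
    exact hρ a α hα)
  exact ⟨h.toFinset, fun v => h.mem_toFinset, finsum_mem_eq_finite_toFinset_sum _ h⟩

theorem map_orbitSum (hfin : R.Finite) (hρ : ∀ a, ∀ α ∈ R, ρ a α ∈ R) {α : V} (hα : α ∈ R)
    (a : A) : ρ a (orbitSum ρ α) = orbitSum ρ α := by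
  obtain ⟨O, hO, hS⟩ := exists_orbit_finset hfin hρ hα
  rw [hS, map_sum]
  refine Finset.sum_equiv (ρ a).toEquiv (fun v => ?_) fun v _ => rfl
  rw [hO, hO]
  constructor
  · rintro ⟨b, rfl⟩
    exact ⟨a * b, by simp⟩
  · rintro ⟨b, hb⟩
    refine ⟨a⁻¹ * b, ?_⟩
    have hb' : ρ b α = ρ a v := hb
    simp only [map_mul, LinearEquiv.mul_apply, hb', map_inv]
    exact (ρ a).symm_apply_apply v

theorem orbitSum_mem_span (hfin : R.Finite) (hρ : ∀ a, ∀ α ∈ R, ρ a α ∈ R) {α : V}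
    (hα : α ∈ R) : orbitSum ρ α ∈ span ℝ R := by
  obtain ⟨O, hO, hS⟩ := exists_orbit_finset hfin hρ hα
  rw [hS]
  refine Submodule.sum_mem _ fun v hv => ?_
  obtain ⟨a, rfl⟩ := (hO v).1 hv
  exact Submodule.subset_span (hρ a α hα)

/-- A linear functional that is constant on the orbit of `α` takes on the orbit sum its value at
`α` times the size of the orbit. -/
theorem exists_apply_orbitSum (hfin : R.Finite) (hρ : ∀ a, ∀ α ∈ R, ρ a α ∈ R) {α : V}
    (hα : α ∈ R) : ∃ n : ℝ, 0 < n ∧ ∀ l : V →ₗ[ℝ] ℝ, (∀ a, l (ρ a α) = l α) →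
      l (orbitSum ρ α) = n * l α := by
  obtain ⟨O, hO, hS⟩ := exists_orbit_finset hfin hρ hα
  refine ⟨O.card, ?_, fun l hl => ?_⟩
  · exact_mod_cast Finset.card_pos.2 ⟨ρ 1 α, (hO _).2 ⟨1, rfl⟩⟩
  · rw [hS, map_sum, Finset.sum_congr rfl (g := fun _ => l α), Finset.sum_const, nsmul_eq_mul]
    intro v hv
    obtain ⟨a, rfl⟩ := (hO v).1 hv
    exact hl a

theorem IsInvariantForm.map_left (hB : IsInvariantForm R B) (hρ : ∀ a, ∀ α ∈ R, ρ a α ∈ R)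
    {α w : V} (hα : α ∈ R) (hw : w ∈ span ℝ R) (hfix : ∀ a, ρ a w = w) (a : A) :
    B (ρ a α) w = B α w := by
  have := hB.map_map (ρ a) (hρ a) α (Submodule.subset_span hα) w hw
  rwa [hfix a] at this

/-- The roots `β` with `α ∼ β` are cut out by linear equations. -/
theorem IsInvariantForm.sim_iff (hB : IsInvariantForm R B) (hfin : R.Finite)
    (hρ : ∀ a, ∀ α ∈ R, ρ a α ∈ R) {ht : V →ₗ[ℝ] ℝ}
    (htρ : ∀ a, ∀ α ∈ R, ht (ρ a α) = ht α) {α β : V} (hα : α ∈ R) (hβ : β ∈ R)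
    (hαpos : 0 < ht α) (hβpos : 0 < ht β) :
    sim ρ α β ↔ ∀ w ∈ span ℝ R, (∀ a, ρ a w = w) →
      B β w * ht (orbitSum ρ α) = ht β * B (orbitSum ρ α) w := by
  obtain ⟨m, hm, hmα⟩ := exists_apply_orbitSum hfin hρ hα
  obtain ⟨n, hn, hnβ⟩ := exists_apply_orbitSum hfin hρ hβ
  have hSα : 0 < ht (orbitSum ρ α) := by
    rw [hmα ht fun a => htρ a α hα]
    positivity
  have htβ := hnβ ht fun a => htρ a β hβ
  have hSβ : 0 < ht (orbitSum ρ β) := by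
    rw [htβ]
    positivity
  have hBβ : ∀ w ∈ span ℝ R, (∀ a, ρ a w = w) → B (orbitSum ρ β) w = n * B β w :=
    fun w hw hfix => hnβ (B.flip w) fun a => hB.map_left hρ hβ hw hfix a
  constructor
  · intro h
    obtain ⟨c, hc⟩ : ∃ c : ℝ, orbitSum ρ β = c • orbitSum ρ α := by
      rcases h with ⟨c, hc⟩ | h
      · have hc0 : c ≠ 0 := by
          rintro rfl
          simp [hc] at hSα
        exact ⟨c⁻¹, by rw [hc, inv_smul_smul₀ hc0]⟩
      · exact h
    intro w hw hfix
    have h1 := hBβ w hw hfix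
    rw [hc, map_smul, LinearMap.smul_apply, smul_eq_mul] at h1
    rw [hc, map_smul, smul_eq_mul] at htβ
    refine mul_left_cancel₀ hn.ne' ?_
    linear_combination (-ht (orbitSum ρ α)) * h1 + B (orbitSum ρ α) w * htβ
  · intro h
    refine Or.inr ⟨ht (orbitSum ρ β) / ht (orbitSum ρ α), ?_⟩
    set c := ht (orbitSum ρ β) / ht (orbitSum ρ α) with hc
    have hc' : c * ht (orbitSum ρ α) = n * ht β := by
      rw [hc, div_mul_cancel₀ _ hSα.ne', htβ]
    have hw : orbitSum ρ β - c • orbitSum ρ α ∈ span ℝ R :=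
      Submodule.sub_mem _ (orbitSum_mem_span hfin hρ hβ)
        (Submodule.smul_mem _ _ (orbitSum_mem_span hfin hρ hα))
    have hfix : ∀ a, ρ a (orbitSum ρ β - c • orbitSum ρ α) =
        orbitSum ρ β - c • orbitSum ρ α := fun a => by
      rw [map_sub, map_smul, map_orbitSum hfin hρ hβ, map_orbitSum hfin hρ hα]
    by_contra hne
    set w := orbitSum ρ β - c • orbitSum ρ α with hwdef
    refine (hB.pos w hw (sub_ne_zero.2 hne)).ne' ?_
    have h1 := hBβ w hw hfix
    have h2 := h w hw hfix
    have h3 : B w w = B (orbitSum ρ β) w - c * B (orbitSum ρ α) w := by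
      nth_rw 1 [hwdef]
      simp
    refine (mul_eq_zero.1 (?_ : ht (orbitSum ρ α) * B w w = 0)).resolve_left hSα.ne'
    linear_combination ht (orbitSum ρ α) * h3 + ht (orbitSum ρ α) * h1 + n * h2
      - B (orbitSum ρ α) w * hc'

end Orbits

end Roots

/-- Let `R` be a reduced crystallographic root system in a finite-dimensional
real vector space `V` with base `Δ`, and let a group `A` act on `V` (via `ρ`) by automorphisms
of `R` preserving `Δ`. Then every equivalence class `E` of the relation `∼` on the positive
roots has one of the following two forms: (i) `E` is a single `A`-orbit and for all `α, β ∈ E`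
the sum `α + β` is not a root; or (ii) there are a positive root `α` and `a ∈ A` with
`α + a • α ∈ R`, and `E` is the disjoint union of the `A`-orbit of `α` and the `A`-orbit of
`α + a • α`. -/
theorem stmt_15 {V A : Type*} [AddCommGroup V] [Module ℝ V] [FiniteDimensional ℝ V] [Group A]
    (R Δ : Set V) (coroot : V → (V →ₗ[ℝ] ℝ))
    (hR : IsRootSystem R coroot) (hΔ : IsBase R coroot Δ)
    (ρ : A →* (V ≃ₗ[ℝ] V))
    (hρR : ∀ a : A, ⇑(ρ a) '' R = R) (hρΔ : ∀ a : A, ⇑(ρ a) '' Δ = Δ)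
    (E : Set V) (hEne : E.Nonempty) (hEpos : E ⊆ posRoots R Δ)
    (hEclass : ∀ α ∈ E, ∀ β ∈ posRoots R Δ, (sim ρ α β ↔ β ∈ E)) :
    ((∃ α₀ ∈ E, E = Set.range fun a : A => ρ a α₀) ∧
      ∀ α ∈ E, ∀ β ∈ E, α + β ∉ R) ∨
    (∃ α ∈ posRoots R Δ, ∃ a : A, α + ρ a α ∈ R ∧
      E = (Set.range fun b : A => ρ b α) ∪ (Set.range fun b : A => ρ b (α + ρ a α)) ∧
      Disjoint (Set.range fun b : A => ρ b α)
        (Set.range fun b : A => ρ b (α + ρ a α))) := by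
  have hρ : ∀ a, ∀ α ∈ R, ρ a α ∈ R := fun a α hα => hρR a ▸ Set.mem_image_of_mem _ hα
  obtain ⟨B, hB⟩ := exists_isInvariantForm hR.finite
  obtain ⟨ht, ht1, ht0, htpos⟩ := hΔ.exists_height hR
  have htρ : ∀ a, ∀ α ∈ R, ht (ρ a α) = ht α := by
    intro a α hα
    have h : Set.EqOn (ht ∘ₗ (ρ a : V →ₗ[ℝ] V)) ht Δ := by
      intro δ hδ
      have : ρ a δ ∈ Δ := hρΔ a ▸ Set.mem_image_of_mem _ hδ
      simp [ht1 _ this, ht1 _ hδ]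
    exact LinearMap.eqOn_span h (hΔ.subset_span hα)
  have hER : ∀ β ∈ E, β ∈ R := fun β hβ => (hEpos hβ).1
  have hEht : ∀ β ∈ E, 0 < ht β := fun β hβ => (htpos β (hER β hβ)).1 (hEpos hβ)
  obtain ⟨α₀, hα₀, hmin⟩ := Set.exists_min_image E ht (hR.finite.subset hER) hEne
  have hα₀R := hER α₀ hα₀
  obtain ⟨O, hO, hS⟩ := exists_orbit_finset hR.finite hρ hα₀R
  let K : Submodule ℝ V :=
    { carrier := {x | ∀ w ∈ Submodule.span ℝ R, (∀ a, ρ a w = w) →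
        B x w * ht (orbitSum ρ α₀) = ht x * B (orbitSum ρ α₀) w}
      zero_mem' := fun w _ _ => by simp
      add_mem' := fun {x y} hx hy w hw hfix => by
        rw [map_add, map_add, LinearMap.add_apply, add_mul, add_mul, hx w hw hfix,
          hy w hw hfix]
      smul_mem' := fun c x hx w hw hfix => by
        rw [map_smul, map_smul, LinearMap.smul_apply, smul_eq_mul, smul_eq_mul, mul_assoc,
          mul_assoc, hx w hw hfix] }
  have hK : ∀ a, ∀ α ∈ R, α ∈ K → ρ a α ∈ K := by
    intro a α hα hαK w hw hfix
    rw [hB.map_left hρ hα hw hfix, htρ a α hα]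
    exact hαK w hw hfix
  have hsim : ∀ β ∈ R, 0 < ht β → (sim ρ α₀ β ↔ β ∈ K) := fun β hβ hβpos =>
    hB.sim_iff hR.finite hρ htρ hα₀R hβ (hEht _ hα₀) hβpos
  have hE : ∀ β, β ∈ E ↔ β ∈ R ∧ β ∈ K ∧ 0 < ht β := by
    intro β
    constructor
    · intro hβ
      exact ⟨hER β hβ, (hsim β (hER β hβ) (hEht β hβ)).1
        ((hEclass α₀ hα₀ β (hEpos hβ)).2 hβ), hEht β hβ⟩
    · rintro ⟨hβ, hβK, hβpos⟩
      exact (hEclass α₀ hα₀ β ((htpos β hβ).2 hβpos)).1 ((hsim β hβ hβpos).2 hβK)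
  obtain ⟨n, hn, hnα₀⟩ := exists_apply_orbitSum hR.finite hρ hα₀R
  have hSpos : 0 < ht (orbitSum ρ α₀) := by
    rw [hnα₀ ht fun a => htρ a α₀ hα₀R]
    exact mul_pos hn (hEht _ hα₀)
  have hSspan := orbitSum_mem_span hR.finite hρ hα₀R
  have hSS : 0 < B (orbitSum ρ α₀) (orbitSum ρ α₀) := hB.pos _ hSspan fun h => by
    simp [h] at hSpos
  have hsum : ∀ β ∈ E, 0 < ∑ v ∈ O, B β v := by
    intro β hβ
    have h := ((hE β).1 hβ).2.1 _ hSspan (map_orbitSum hR.finite hρ hα₀R)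
    rw [← map_sum, ← hS]
    refine pos_of_mul_pos_left (b := ht (orbitSum ρ α₀)) ?_ hSpos.le
    rw [h]
    exact mul_pos (hEht β hβ) hSS
  rcases hB.orbit_dichotomy hR hρ ht0 htρ hK hE hα₀ hmin hO hsum with
    ⟨h, h'⟩ | ⟨α, hα, h⟩
  · exact Or.inl ⟨⟨α₀, hα₀, h⟩, h'⟩
  · exact Or.inr ⟨α, hEpos hα, h⟩
end
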